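/- For an orthohedral set S and k ≤ rk(S), the quotient C(Γ^k(S))/C^{ord}(Γ^k(S)) is isomorphic to the finitary direct sum ⊕_{γ ∈ Γ^k(S)} Sym_k, via the action of C(Γ^k(S)) on the k canonical coordinate directions X(γ) of each tangent coset ⟨γ⟩. -/

import Mathlib

open Pointwise

namespace PeiPaper

/-- Points of the face of the standard orthant spanned by the canonical basis vectors in `Y`. -/
def stdFace (N : ℕ) (Y : Finset (Fin N)) : Set (Fin N → ℤ) :=
  {v | (∀ i, 0 ≤ v i) ∧ ∀ i, i ∉ Y → v i = 0}

/-- Integral orthogonal matrix. -/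
def IsOrthMat {N : ℕ} (A : Matrix (Fin N) (Fin N) ℤ) : Prop :=
  A * A.transpose = 1

/-- `L` is an integral orthant of rank `k` in `ℤ^N`: an affine-orthogonal image of a
rank-`k` face of the standard orthant. -/
def IsOrthantOfRank {N : ℕ} (L : Set (Fin N → ℤ)) (k : ℕ) : Prop :=
  ∃ (a : Fin N → ℤ) (A : Matrix (Fin N) (Fin N) ℤ) (Y : Finset (Fin N)),
    IsOrthMat A ∧ Y.card = k ∧ L = (fun v => a + A.mulVec v) '' stdFace N Y

def IsOrthant {N : ℕ} (L : Set (Fin N → ℤ)) : Prop := ∃ k, IsOrthantOfRank L k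

/-- `S` is orthohedral: a finite union of integral orthants. -/
def IsOrthohedral {N : ℕ} (S : Set (Fin N → ℤ)) : Prop :=
  ∃ 𝓛 : Set (Set (Fin N → ℤ)), 𝓛.Finite ∧ (∀ L ∈ 𝓛, IsOrthant L) ∧ S = ⋃₀ 𝓛

/-- The rank of a set: the maximal rank of an orthant contained in it. -/
noncomputable def orthRank {N : ℕ} (S : Set (Fin N → ℤ)) : ℕ :=
  sSup {k | ∃ L, IsOrthantOfRank L k ∧ L ⊆ S}

/-- Commensurability: the intersection is nonempty and has the same rank as both sets. -/
def Commensurable {N : ℕ} (L L' : Set (Fin N → ℤ)) : Prop :=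
  (L ∩ L').Nonempty ∧ orthRank L = orthRank (L ∩ L') ∧ orthRank L' = orthRank (L ∩ L')

/-- The rank-`k` orthants contained in `S`. -/
def germSet {N : ℕ} (S : Set (Fin N → ℤ)) (k : ℕ) : Set (Set (Fin N → ℤ)) :=
  {L | IsOrthantOfRank L k ∧ L ⊆ S}

/-- The rank-`k` germs of `S`: commensurability classes of rank-`k` orthants of `S`. -/
def Germ {N : ℕ} (S : Set (Fin N → ℤ)) (k : ℕ) : Type _ :=
  Quot (fun L L' : germSet S k => Commensurable L.1 L'.1)

def germOf {N : ℕ} (S : Set (Fin N → ℤ)) (k : ℕ) (L : germSet S k) : Germ S k :=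
  Quot.mk _ L

/-- The number of rank-`k` germs of `S` (as a natural number; `0` if infinite). -/
noncomputable def heightAt {N : ℕ} (S : Set (Fin N → ℤ)) (k : ℕ) : ℕ :=
  Nat.card (Germ S k)

/-- The height of an orthohedral set: the number of germs of maximal rank. -/
noncomputable def height {N : ℕ} (S : Set (Fin N → ℤ)) : ℕ :=
  heightAt S (orthRank S)

/-- `f` is (the restriction of) an isometry of `ℤ^N` on `L`. -/
def IsometricOn {N : ℕ} (f : (Fin N → ℤ) → (Fin N → ℤ)) (L : Set (Fin N → ℤ)) : Prop :=
  ∃ (a : Fin N → ℤ) (A : Matrix (Fin N) (Fin N) ℤ),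
    IsOrthMat A ∧ ∀ x ∈ L, f x = a + A.mulVec x

/-- `f` is (the restriction of) a translation on `L`. -/
def TranslationOn {N : ℕ} (f : (Fin N → ℤ) → (Fin N → ℤ)) (L : Set (Fin N → ℤ)) : Prop :=
  ∃ a : Fin N → ℤ, ∀ x ∈ L, f x = a + x

/-- `f` is a piecewise-Euclidean-isometric map on `S`. -/
def IsPeiMapOn {N : ℕ} (S : Set (Fin N → ℤ)) (f : (Fin N → ℤ) → (Fin N → ℤ)) : Prop :=
  ∃ 𝓛 : Set (Set (Fin N → ℤ)), 𝓛.Finite ∧ (∀ L ∈ 𝓛, IsOrthant L) ∧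
    S = ⋃₀ 𝓛 ∧ 𝓛.PairwiseDisjoint id ∧ ∀ L ∈ 𝓛, IsometricOn f L

/-- `f` is a piecewise-Euclidean-translation map on `S`. -/
def IsPetMapOn {N : ℕ} (S : Set (Fin N → ℤ)) (f : (Fin N → ℤ) → (Fin N → ℤ)) : Prop :=
  ∃ 𝓛 : Set (Set (Fin N → ℤ)), 𝓛.Finite ∧ (∀ L ∈ 𝓛, IsOrthant L) ∧
    S = ⋃₀ 𝓛 ∧ 𝓛.PairwiseDisjoint id ∧ ∀ L ∈ 𝓛, TranslationOn f L

def IsPeiIso {N : ℕ} (S S' : Set (Fin N → ℤ)) (f : (Fin N → ℤ) → (Fin N → ℤ)) : Prop :=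
  IsPeiMapOn S f ∧ Set.InjOn f S ∧ f '' S = S'

def PeiIsomorphic {N : ℕ} (S S' : Set (Fin N → ℤ)) : Prop := ∃ f, IsPeiIso S S' f

def IsPetIso {N : ℕ} (S S' : Set (Fin N → ℤ)) (f : (Fin N → ℤ) → (Fin N → ℤ)) : Prop :=
  IsPetMapOn S f ∧ Set.InjOn f S ∧ f '' S = S'

def PetIsomorphic {N : ℕ} (S S' : Set (Fin N → ℤ)) : Prop := ∃ f, IsPetIso S S' f

/-- A pei-permutation of `S`: a permutation of `ℤ^N` supported on `S` which is pei on `S`. -/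
def IsPeiPerm {N : ℕ} (S : Set (Fin N → ℤ)) (g : Equiv.Perm (Fin N → ℤ)) : Prop :=
  IsPeiMapOn S ⇑g ∧ ∀ x ∉ S, g x = x

/-- The element `g` has rank at most `k`: it is supported on an orthohedral set of rank `≤ k`. -/
def rankLE {N : ℕ} (g : Equiv.Perm (Fin N → ℤ)) (k : ℕ) : Prop :=
  ∃ T : Set (Fin N → ℤ), IsOrthohedral T ∧ orthRank T ≤ k ∧ ∀ x ∉ T, g x = x

/-- `g` fixes every rank-`k` germ of `S`. -/
def FixesGerm {N : ℕ} (S : Set (Fin N → ℤ)) (k : ℕ) (g : Equiv.Perm (Fin N → ℤ)) : Prop :=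
  ∀ L, IsOrthantOfRank L k → L ⊆ S →
    ∃ L', IsOrthantOfRank L' k ∧ L' ⊆ L ∧ Commensurable L L' ∧
      IsometricOn (⇑g) L' ∧ Commensurable (⇑g '' L') L

/-- `g` fixes every rank-`k` germ of `S` and acts on its tangent coset by a translation. -/
def TranslatesGerm {N : ℕ} (S : Set (Fin N → ℤ)) (k : ℕ) (g : Equiv.Perm (Fin N → ℤ)) : Prop :=
  ∀ L, IsOrthantOfRank L k → L ⊆ S →
    ∃ L' a, IsOrthantOfRank L' k ∧ L' ⊆ L ∧ Commensurable L L' ∧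
      (∀ x ∈ L', g x = a + x) ∧ Commensurable (⇑g '' L') L

/-- `σ` is the map induced by `g` on the rank-`k` germs of `S`. -/
def InducesGermMap {N : ℕ} (S : Set (Fin N → ℤ)) (k : ℕ) (g : Equiv.Perm (Fin N → ℤ))
    (σ : Germ S k → Germ S k) : Prop :=
  ∀ L : germSet S k, ∃ (L'' : Set (Fin N → ℤ)) (M : germSet S k),
    IsOrthantOfRank L'' k ∧ L'' ⊆ L.1 ∧ Commensurable L.1 L'' ∧
    M.1 = ⇑g '' L'' ∧ σ (germOf S k L) = germOf S k M

/-- A finitary permutation which is even (has sign `1` on a finite invariant subset). -/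
def IsEvenFinitary {α : Type*} (σ : Equiv.Perm α) : Prop :=
  ∃ (F : Finset α) (σF : Equiv.Perm F),
    (∀ a ∉ F, σ a = a) ∧ (∀ a : F, σ (a : α) = (σF a : α)) ∧
    @Equiv.Perm.sign F (Classical.decEq _) inferInstance σF = 1

/-- `g` induces an even finitary permutation on the rank-`k` germs of `S`. -/
def IsEvenOnGerms {N : ℕ} (S : Set (Fin N → ℤ)) (k : ℕ) (g : Equiv.Perm (Fin N → ℤ)) : Prop :=
  ∃ σ : Equiv.Perm (Germ S k), InducesGermMap S k g ⇑σ ∧ IsEvenFinitary σ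

/-- Ordering of germs (of arbitrary ranks): `p ≤ q` if they have representatives `L ⊆ L'`. -/
def germLE {N : ℕ} (S : Set (Fin N → ℤ)) (p q : Σ k, Germ S k) : Prop :=
  ∃ (L : germSet S p.1) (L' : germSet S q.1),
    germOf S p.1 L = p.2 ∧ germOf S q.1 L' = q.2 ∧ L.1 ⊆ L'.1

/-- A maximal germ of `S`. -/
def IsMaxGerm {N : ℕ} (S : Set (Fin N → ℤ)) (p : Σ k, Germ S k) : Prop :=
  ∀ q, germLE S p q → germLE S q p

/-- A `0`-based orthant. -/
def IsBasedOrthant {N : ℕ} (L0 : Set (Fin N → ℤ)) : Prop :=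
  ∃ (A : Matrix (Fin N) (Fin N) ℤ) (Y : Finset (Fin N)),
    IsOrthMat A ∧ L0 = (fun v => A.mulVec v) '' stdFace N Y

/-- Two (oriented) parallel orthants. -/
def ParallelOrthants {N : ℕ} (L L' : Set (Fin N → ℤ)) : Prop :=
  ∃ a : Fin N → ℤ, L' = a +ᵥ L

/-- The indicator image `S_τ` of `S`: the union of the `0`-based parallel translates of
the orthants contained in `S`. -/
def indicatorImage {N : ℕ} (S : Set (Fin N → ℤ)) : Set (Fin N → ℤ) :=
  ⋃₀ {L0 | IsBasedOrthant L0 ∧ ∃ a : Fin N → ℤ, (a +ᵥ L0) ⊆ S}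

/-- The height function `h_S`: the number of maximal germs of `S` whose indicator is `L0`. -/
noncomputable def hFun {N : ℕ} (S : Set (Fin N → ℤ)) (L0 : Set (Fin N → ℤ)) : ℕ :=
  Nat.card {p : Σ k, Germ S k //
    IsMaxGerm S p ∧ ∃ L : germSet S p.1, germOf S p.1 L = p.2 ∧ ∃ a : Fin N → ℤ, L.1 = a +ᵥ L0}

/-- `S` is quasi-normal: the maximal based orthants of `S_τ` are exactly the support of `h_S`. -/
def QuasiNormal {N : ℕ} (S : Set (Fin N → ℤ)) : Prop :=
  ∀ L0 : Set (Fin N → ℤ),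
    (IsBasedOrthant L0 ∧ L0 ⊆ indicatorImage S ∧
      ∀ L1, IsBasedOrthant L1 → L1 ⊆ indicatorImage S → L0 ⊆ L1 → L1 ⊆ L0)
    ↔ (IsBasedOrthant L0 ∧ 0 < hFun S L0)

/-- The germ `q` of `S'` is the image of the germ `p` of `S` under the injective pei-map `f`. -/
def GermMapsTo {N : ℕ} (f : (Fin N → ℤ) → (Fin N → ℤ)) (S S' : Set (Fin N → ℤ))
    (p : Σ k, Germ S k) (q : Σ k, Germ S' k) : Prop :=
  p.1 = q.1 ∧ ∃ (L : germSet S p.1) (L'' : Set (Fin N → ℤ)) (M : germSet S' q.1),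
    germOf S p.1 L = p.2 ∧ IsOrthantOfRank L'' p.1 ∧ L'' ⊆ L.1 ∧ Commensurable L.1 L'' ∧
    M.1 = f '' L'' ∧ germOf S' q.1 M = q.2

/-- A stack of `h` parallel rank-`n` orthants. -/
def IsStack {N : ℕ} (S : Set (Fin N → ℤ)) (n h : ℕ) : Prop :=
  ∃ (L0 : Set (Fin N → ℤ)) (a : Fin h → (Fin N → ℤ)),
    IsOrthantOfRank L0 n ∧
    (Pairwise fun i j => Disjoint (a i +ᵥ L0) (a j +ᵥ L0)) ∧
    S = ⋃ i, a i +ᵥ L0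

/-- A coordinate half-space of `ℤ^N`. -/
def IsHalfSpace {N : ℕ} (H : Set (Fin N → ℤ)) : Prop :=
  ∃ (i : Fin N) (c : ℤ), H = {x | x i ≤ c} ∨ H = {x | c ≤ x i}

/-- The canonical embedding `ℤ^N → ℤ^{N+1}`. -/
def emb (N : ℕ) (x : Fin N → ℤ) : Fin (N + 1) → ℤ :=
  fun i => if h : (i : ℕ) < N then x ⟨i, h⟩ else 0

/-- The sum of all matrix entries of a finitely supported family of vectors. -/
noncomputable def totalSum (k : ℕ) (Γ : Type*) : (Γ →₀ (Fin k → ℤ)) →+ ℤ :=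
  Finsupp.liftAddHom (fun _ => ∑ i : Fin k, Pi.evalAddMonoidHom (fun _ => ℤ) i)

/-- The clique (flag) complex of a graph. -/
def cliqueComplex {V : Type*} (G : SimpleGraph V) : Set (Finset V) :=
  {s | s.Nonempty ∧ G.IsClique (s : Set V)}

/-- The geometric realization of a simplicial complex on vertex set `V`. -/
def realization {V : Type*} (K : Set (Finset V)) : Set (V → ℝ) :=
  {f | (∀ v, 0 ≤ f v) ∧ ∃ s ∈ K, Function.support f ⊆ ↑s ∧ ∑ v ∈ s, f v = 1}

/-- A wedge (bouquet) of `n`-spheres indexed by `ι`, with basepoint `b`. -/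
noncomputable def wedgeSpheres (ι : Type) (n : ℕ)
    (b : Metric.sphere (0 : EuclideanSpace ℝ (Fin (n + 1))) 1) : Type :=
  Quot (fun p q : Unit ⊕ (ι × Metric.sphere (0 : EuclideanSpace ℝ (Fin (n + 1))) 1) =>
    (Sum.elim (fun _ => True) (fun pr => pr.2 = b) p) ∧
    (Sum.elim (fun _ => True) (fun qr => qr.2 = b) q))

noncomputable instance (ι : Type) (n : ℕ) (b : Metric.sphere (0 : EuclideanSpace ℝ (Fin (n + 1))) 1) :
    TopologicalSpace (wedgeSpheres ι n b) :=
  letI : TopologicalSpace ι := ⊥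
  instTopologicalSpaceQuot


/-- The set of points of `ℤ^N` whose `j`-th coordinate is equal to, at least or at most `p j`,
according to the sign `s j`. -/
def cone {N : ℕ} (p : Fin N → ℤ) (s : Fin N → SignType) : Set (Fin N → ℤ) :=
  {x | ∀ j, (s j = 0 → x j = p j) ∧ (s j = 1 → p j ≤ x j) ∧ (s j = -1 → x j ≤ p j)}

/-- The number of nonzero signs. -/
def signRank {N : ℕ} (s : Fin N → SignType) : ℕ :=
  (Finset.univ.filter fun j => s j ≠ 0).card

/-- `p` and `q` agree at the coordinates where `s` vanishes. -/
def AgreeOffSupport {N : ℕ} (s : Fin N → SignType) (p q : Fin N → ℤ) : Prop :=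
  ∀ j, s j = 0 → p j = q j

lemma exists_unit_of_sum_mul_self_eq_one {ι : Type*} [Fintype ι] [DecidableEq ι] (v : ι → ℤ)
    (h : ∑ l, v l * v l = 1) : ∃ l, (v l = 1 ∨ v l = -1) ∧ ∀ l', l' ≠ l → v l' = 0 := by
  have hne : ∃ l, v l ≠ 0 := by
    by_contra! hc
    simp [hc] at h
  obtain ⟨l, hl⟩ := hne
  have hsum := Finset.add_sum_erase Finset.univ (fun l => v l * v l) (Finset.mem_univ l)
  simp only [h] at hsum
  have hnn : ∀ i ∈ Finset.univ.erase l, 0 ≤ v i * v i := fun i _ => mul_self_nonneg _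
  have hpos : 0 < v l * v l := mul_self_pos.2 hl
  have hrest := Finset.sum_nonneg hnn
  have hl1 : v l * v l = 1 := by omega
  refine ⟨l, mul_self_eq_one_iff.1 hl1, fun l' hl' => ?_⟩
  have h0 : ∑ x ∈ Finset.univ.erase l, v x * v x = 0 := by omega
  have := (Finset.sum_eq_zero_iff_of_nonneg hnn).1 h0 l' (by simp [hl'])
  simpa using this

/-- Integral orthogonal matrices act as signed permutations of the coordinates. -/
lemma IsOrthMat.exists_perm {N : ℕ} {A : Matrix (Fin N) (Fin N) ℤ} (hA : IsOrthMat A) :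
    ∃ (τ : Equiv.Perm (Fin N)) (ε : Fin N → ℤ), (∀ j, ε j = 1 ∨ ε j = -1) ∧
      ∀ v j, A.mulVec v j = ε j * v (τ j) := by
  have hrow : ∀ j j', ∑ l, A j l * A j' l = if j = j' then 1 else 0 := fun j j' => by
    have := congrFun (congrFun hA j) j'
    simpa [Matrix.mul_apply, Matrix.one_apply] using this
  have hunit : ∀ j, ∃ l, (A j l = 1 ∨ A j l = -1) ∧ ∀ l', l' ≠ l → A j l' = 0 := fun j =>
    exists_unit_of_sum_mul_self_eq_one (A j) (by simpa using hrow j j)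
  choose τ hτ hz using hunit
  have hinj : Function.Injective τ := by
    intro j j' hjj'
    by_contra hne
    have h := hrow j j'
    rw [if_neg hne, Finset.sum_eq_single (τ j)
      (fun l _ hl => by rw [hz j l hl, zero_mul]) (by simp)] at h
    have h1 := hτ j
    have h2 := hτ j'
    rw [← hjj'] at h2
    rcases h1 with h1 | h1 <;> rcases h2 with h2 | h2 <;> simp [h1, h2] at h
  refine ⟨Equiv.ofBijective τ (Finite.injective_iff_bijective.1 hinj), fun j => A j (τ j), hτ,
    fun v j => ?_⟩
  rw [Matrix.mulVec, dotProduct, Finset.sum_eq_single (τ j)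
      (fun l _ hl => by rw [hz j l hl, zero_mul]) (by simp)]
  rfl

lemma exists_isOrthMat {N : ℕ} (τ : Equiv.Perm (Fin N)) (ε : Fin N → ℤ)
    (hε : ∀ j, ε j = 1 ∨ ε j = -1) :
    ∃ A : Matrix (Fin N) (Fin N) ℤ, IsOrthMat A ∧ ∀ v j, A.mulVec v j = ε j * v (τ j) := by
  refine ⟨Matrix.of fun j l => if l = τ j then ε j else 0, ?_, fun v j => ?_⟩
  · ext j j'
    have : ε j * ε j = 1 := by rcases hε j with h | h <;> simp [h]
    by_cases h : j = j'
    · subst h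
      simp [Matrix.mul_apply, this]
    · simp [Matrix.mul_apply, Matrix.one_apply_ne h, Ne.symm h]
  · simp [Matrix.mulVec, dotProduct]

lemma self_mem_cone {N : ℕ} (p : Fin N → ℤ) (s : Fin N → SignType) : p ∈ cone p s :=
  fun _ => ⟨fun _ => rfl, fun _ => le_rfl, fun _ => le_rfl⟩

lemma add_mul_mem_cone {N : ℕ} (p : Fin N → ℤ) (s : Fin N → SignType) (r : ℕ) :
    (fun j => p j + r * (s j : ℤ)) ∈ cone p s := by
  intro j
  refine ⟨fun h => ?_, fun h => ?_, fun h => ?_⟩ <;> simp [h]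

lemma isOrthantOfRank_iff {N : ℕ} {L : Set (Fin N → ℤ)} {k : ℕ} :
    IsOrthantOfRank L k ↔ ∃ p s, signRank s = k ∧ L = cone p s := by
  constructor
  · rintro ⟨a, A, Y, hA, hY, rfl⟩
    obtain ⟨τ, ε, hε, hAv⟩ := hA.exists_perm
    have hs : ∀ j, SignType.sign (ε j) ≠ 0 := fun j => by
      rcases hε j with h | h <;> simp [h]
    refine ⟨a, fun j => if τ j ∈ Y then SignType.sign (ε j) else 0, ?_, ?_⟩
    · rw [← hY, signRank]
      refine Finset.card_bij (fun j _ => τ j) (fun j hj => ?_) (fun _ _ _ _ h => τ.injective h)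
        (fun l hl => ⟨τ.symm l, by simp [hl, hs], by simp⟩)
      by_contra hc
      simp [hc] at hj
    · ext x
      constructor
      · rintro ⟨v, ⟨hv, hv0⟩, rfl⟩ j
        have h1 := hv (τ j)
        have h2 := hv0 (τ j)
        simp only [Pi.add_apply, hAv]
        by_cases hj : τ j ∈ Y <;> rcases hε j with h | h <;> simp [h, hj, h1, h2]
      · intro hx
        refine ⟨fun l => ε (τ.symm l) * (x (τ.symm l) - a (τ.symm l)), ⟨fun l => ?_, fun l hl => ?_⟩, ?_⟩
        · have := hx (τ.symm l)
          by_cases hj : l ∈ Y <;> rcases hε (τ.symm l) with h | h <;> simp [h, hj] at this ⊢ <;>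
            omega
        · have := (hx (τ.symm l)).1 (by simp [hl])
          simp [this]
        · ext j
          simp only [Pi.add_apply, hAv, Equiv.symm_apply_apply]
          rcases hε j with h | h <;> simp [h]
  · rintro ⟨p, s, hs, rfl⟩
    have hε : ∀ j, (if s j = -1 then (-1 : ℤ) else 1) = 1 ∨
        (if s j = -1 then (-1 : ℤ) else 1) = -1 := fun j => by
      split_ifs <;> simp
    obtain ⟨A, hA, hAv⟩ := exists_isOrthMat (Equiv.refl _) _ hε
    refine ⟨p, A, _, hA, hs, ?_⟩
    ext x
    constructor
    · intro hx
      refine ⟨fun j => (if s j = -1 then (-1 : ℤ) else 1) * (x j - p j),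
        ⟨fun j => ?_, fun j hj => ?_⟩, ?_⟩
      · have := hx j
        rcases SignType.trichotomy (s j) with h | h | h <;> simp [h] at this ⊢ <;> omega
      · have := (hx j).1 (by simpa using hj)
        simp [this]
      · ext j
        simp only [Pi.add_apply, hAv, Equiv.refl_apply]
        by_cases h : s j = -1 <;> simp [h]
    · rintro ⟨v, ⟨hv, hv0⟩, rfl⟩ j
      have h1 := hv j
      have h2 := hv0 j
      simp only [Pi.add_apply, hAv, Equiv.refl_apply]
      rcases SignType.trichotomy (s j) with h | h | h <;> simp [h] at h2 ⊢ <;> omega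

lemma cone_subset_cone_iff {N : ℕ} {p q : Fin N → ℤ} {s t : Fin N → SignType} :
    cone q t ⊆ cone p s ↔ q ∈ cone p s ∧ ∀ j, t j ≠ 0 → s j = t j := by
  constructor
  · intro h
    refine ⟨h (self_mem_cone q t), fun j hj => ?_⟩
    have h0 := h (self_mem_cone q t) j
    obtain ⟨r, hr⟩ : ∃ r : ℕ, q j - p j < r ∧ p j - q j < r :=
      ⟨(q j).natAbs + (p j).natAbs + 1, by omega⟩
    have h1 := h (add_mul_mem_cone q t r) j
    rcases SignType.trichotomy (s j) with hs | hs | hs <;>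
    rcases SignType.trichotomy (t j) with ht | ht | ht <;>
    simp [hs, ht] at hj h0 h1 ⊢ <;> omega
  · rintro ⟨h0, h⟩ x hx j
    have h0 := h0 j
    have hx := hx j
    have h := h j
    rcases SignType.trichotomy (s j) with hs | hs | hs <;>
    rcases SignType.trichotomy (t j) with ht | ht | ht <;>
    simp [hs, ht] at h0 hx h ⊢ <;> omega

lemma signRank_le_of_subset {N : ℕ} {p q : Fin N → ℤ} {s t : Fin N → SignType}
    (h : cone q t ⊆ cone p s) : signRank t ≤ signRank s := by
  refine Finset.card_le_card fun j hj => ?_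
  simp only [Finset.mem_filter, Finset.mem_univ, true_and] at hj ⊢
  rwa [(cone_subset_cone_iff.1 h).2 j hj]

lemma eq_of_signRank_le {N : ℕ} {s t : Fin N → SignType} (h : ∀ j, t j ≠ 0 → s j = t j)
    (hr : signRank s ≤ signRank t) : s = t := by
  have hsub : (Finset.univ.filter fun j => t j ≠ 0) ⊆ Finset.univ.filter fun j => s j ≠ 0 := by
    intro j hj
    simp only [Finset.mem_filter, Finset.mem_univ, true_and] at hj ⊢
    rwa [h j hj]
  have heq := Finset.eq_of_subset_of_card_le hsub hr
  ext1 j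
  by_cases hj : t j = 0
  · have : j ∉ Finset.univ.filter fun j => s j ≠ 0 := by rw [← heq]; simp [hj]
    simp at this
    rw [this, hj]
  · exact h j hj

lemma signRank_le {N : ℕ} (s : Fin N → SignType) : signRank s ≤ N :=
  (Finset.card_le_univ _).trans (by simp)

lemma IsOrthantOfRank.nonempty {N : ℕ} {L : Set (Fin N → ℤ)} {k : ℕ}
    (h : IsOrthantOfRank L k) : L.Nonempty := by
  obtain ⟨p, s, -, rfl⟩ := isOrthantOfRank_iff.1 h
  exact ⟨p, self_mem_cone p s⟩

lemma bddAbove_ranks {N : ℕ} (X : Set (Fin N → ℤ)) :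
    BddAbove {k | ∃ L, IsOrthantOfRank L k ∧ L ⊆ X} := by
  refine ⟨N, ?_⟩
  rintro k ⟨L, hL, -⟩
  obtain ⟨p, s, rfl, -⟩ := isOrthantOfRank_iff.1 hL
  exact signRank_le s

lemma le_orthRank {N : ℕ} {X L : Set (Fin N → ℤ)} {k : ℕ} (hL : IsOrthantOfRank L k)
    (h : L ⊆ X) : k ≤ orthRank X :=
  le_csSup (bddAbove_ranks X) ⟨L, hL, h⟩

lemma exists_orthant_of_nonempty {N : ℕ} {X : Set (Fin N → ℤ)} (h : X.Nonempty) :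
    ∃ L, IsOrthantOfRank L (orthRank X) ∧ L ⊆ X := by
  obtain ⟨x, hx⟩ := h
  have h0 : IsOrthantOfRank (cone x 0) 0 :=
    isOrthantOfRank_iff.2 ⟨x, 0, by simp [signRank], rfl⟩
  refine Nat.sSup_mem (s := {k | ∃ L, IsOrthantOfRank L k ∧ L ⊆ X}) ⟨0, _, h0, ?_⟩
    (bddAbove_ranks X)
  intro y hy
  have : y = x := funext fun j => (hy j).1 rfl
  rwa [this]

lemma orthRank_eq {N : ℕ} {X L M : Set (Fin N → ℤ)} {k : ℕ} (hL : IsOrthantOfRank L k)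
    (hM : IsOrthantOfRank M k) (hLX : L ⊆ X) (hXM : X ⊆ M) : orthRank X = k := by
  refine le_antisymm ?_ (le_orthRank hL hLX)
  obtain ⟨L', hL', hL'X⟩ := exists_orthant_of_nonempty (hL.nonempty.mono hLX)
  obtain ⟨p, s, hs, rfl⟩ := isOrthantOfRank_iff.1 hL'
  obtain ⟨q, t, rfl, rfl⟩ := isOrthantOfRank_iff.1 hM
  rw [← hs]
  exact signRank_le_of_subset (hL'X.trans hXM)

lemma commensurable_iff {N : ℕ} {L L' : Set (Fin N → ℤ)} {k : ℕ} (hL : IsOrthantOfRank L k)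
    (hL' : IsOrthantOfRank L' k) :
    Commensurable L L' ↔ ∃ M, IsOrthantOfRank M k ∧ M ⊆ L ∩ L' := by
  constructor
  · rintro ⟨hne, h1, -⟩
    rw [orthRank_eq hL hL le_rfl le_rfl] at h1
    exact h1 ▸ exists_orthant_of_nonempty hne
  · rintro ⟨M, hM, h⟩
    have hr := orthRank_eq hM hL h Set.inter_subset_left
    exact ⟨hM.nonempty.mono h, by rw [hr, orthRank_eq hL hL le_rfl le_rfl],
      by rw [hr, orthRank_eq hL' hL' le_rfl le_rfl]⟩

lemma cone_inter_of_agree {N : ℕ} {p q : Fin N → ℤ} {s : Fin N → SignType}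
    (h : AgreeOffSupport s p q) :
    ∃ r, AgreeOffSupport s p r ∧ cone r s ⊆ cone p s ∧ cone r s ⊆ cone q s := by
  refine ⟨fun j => if s j = 1 then max (p j) (q j) else if s j = -1 then min (p j) (q j) else p j,
    fun j hj => by simp [hj], cone_subset_cone_iff.2 ⟨fun j => ?_, fun _ _ => rfl⟩,
    cone_subset_cone_iff.2 ⟨fun j => ?_, fun _ _ => rfl⟩⟩
  · rcases SignType.trichotomy (s j) with hs | hs | hs <;> simp [hs]
  · have := h j
    rcases SignType.trichotomy (s j) with hs | hs | hs <;> simp_all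

lemma commensurable_cone_iff {N : ℕ} {p q : Fin N → ℤ} {s t : Fin N → SignType}
    (hr : signRank s = signRank t) :
    Commensurable (cone p s) (cone q t) ↔ s = t ∧ AgreeOffSupport s p q := by
  rw [commensurable_iff (k := signRank s) (isOrthantOfRank_iff.2 ⟨p, s, rfl, rfl⟩)
    (isOrthantOfRank_iff.2 ⟨q, t, hr.symm, rfl⟩)]
  constructor
  · rintro ⟨M, hM, h⟩
    obtain ⟨r, u, hu, rfl⟩ := isOrthantOfRank_iff.1 hM
    obtain ⟨h1, h2⟩ := Set.subset_inter_iff.1 h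
    rw [cone_subset_cone_iff] at h1 h2
    obtain rfl := eq_of_signRank_le h1.2 hu.ge
    obtain rfl := eq_of_signRank_le h2.2 (hr ▸ hu.ge)
    exact ⟨rfl, fun j hj => ((h1.1 j).1 hj).symm.trans ((h2.1 j).1 hj)⟩
  · rintro ⟨rfl, h⟩
    obtain ⟨r, -, h1, h2⟩ := cone_inter_of_agree h
    exact ⟨_, isOrthantOfRank_iff.2 ⟨r, s, rfl, rfl⟩, Set.subset_inter h1 h2⟩

lemma germOf_eq_iff {N : ℕ} {S : Set (Fin N → ℤ)} {k : ℕ} (L L' : germSet S k) :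
    germOf S k L = germOf S k L' ↔ Commensurable L.1 L'.1 := by
  refine ⟨fun h => ?_, fun h => Quot.sound h⟩
  have heq : Equivalence fun L L' : germSet S k => Commensurable L.1 L'.1 := by
    refine ⟨fun L => ?_, fun {L M} h => ⟨Set.inter_comm _ _ ▸ h.1, Set.inter_comm _ _ ▸ h.2.2,
      Set.inter_comm _ _ ▸ h.2.1⟩, fun {L M P} h1 h2 => ?_⟩
    · exact (commensurable_iff L.2.1 L.2.1).2 ⟨L.1, L.2.1, by simp⟩
    · obtain ⟨p, s, hs, hL⟩ := isOrthantOfRank_iff.1 L.2.1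
      obtain ⟨q, t, ht, hM⟩ := isOrthantOfRank_iff.1 M.2.1
      obtain ⟨r, u, hu, hP⟩ := isOrthantOfRank_iff.1 P.2.1
      rw [hL, hM, commensurable_cone_iff (hs.trans ht.symm)] at h1
      rw [hM, hP, commensurable_cone_iff (ht.trans hu.symm)] at h2
      rw [hL, hP, commensurable_cone_iff (hs.trans hu.symm)]
      obtain ⟨rfl, h1⟩ := h1
      obtain ⟨rfl, h2⟩ := h2
      exact ⟨rfl, fun j hj => (h1 j hj).trans (h2 j hj)⟩
  exact heq.eqvGen_iff.1 (Quot.eqvGen_exact h)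

lemma IsOrthantOfRank.image_of_isometricOn {N : ℕ} {L : Set (Fin N → ℤ)} {k : ℕ}
    {f : (Fin N → ℤ) → (Fin N → ℤ)} (hL : IsOrthantOfRank L k) (hf : IsometricOn f L) :
    IsOrthantOfRank (f '' L) k := by
  obtain ⟨a, A, Y, hA, hY, rfl⟩ := hL
  obtain ⟨b, B, hB, hf⟩ := hf
  refine ⟨b + B.mulVec a, B * A, Y, ?_, hY, ?_⟩
  · have hA' : A * A.transpose = 1 := hA
    have hB' : B * B.transpose = 1 := hB
    rw [IsOrthMat, Matrix.transpose_mul, Matrix.mul_assoc, ← Matrix.mul_assoc A, hA',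
      Matrix.one_mul, hB']
  · rw [Set.image_image]
    refine Set.image_congr fun v hv => ?_
    rw [hf _ (Set.mem_image_of_mem _ hv), Matrix.mulVec_add, Matrix.mulVec_mulVec, add_assoc]

/-- The affine coordinates on the tangent coset of `cone p s` given by an enumeration of the
support of `s`. -/
def chart {N k : ℕ} (p : Fin N → ℤ) {s : Fin N → SignType} (e : Fin k ≃ {j // s j ≠ 0})
    (n : Fin k → ℤ) : Fin N → ℤ :=
  fun j => if h : s j ≠ 0 then p j + s j * n (e.symm ⟨j, h⟩) else p j

section Chart

variable {N k : ℕ} {p q : Fin N → ℤ} {s t : Fin N → SignType} {e : Fin k ≃ {j // s j ≠ 0}}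

lemma exists_index (e : Fin k ≃ {j // s j ≠ 0}) {j : Fin N} (h : s j ≠ 0) :
    ∃ i, (e i : Fin N) = j :=
  ⟨e.symm ⟨j, h⟩, by simp⟩

lemma chart_apply (n : Fin k → ℤ) (i : Fin k) :
    chart p e n (e i) = p (e i) + s (e i) * n i := by
  simp [chart, (e i).2]

lemma chart_of_eq_zero (n : Fin k → ℤ) {j : Fin N} (h : s j = 0) : chart p e n j = p j := by
  simp [chart, h]

lemma agree_chart (n : Fin k → ℤ) : AgreeOffSupport s p (chart p e n) :=
  fun _ hj => (chart_of_eq_zero n hj).symm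

lemma chart_ext {n : Fin k → ℤ} {x : Fin N → ℤ} (h0 : AgreeOffSupport s p x)
    (h : ∀ i, x (e i) = p (e i) + s (e i) * n i) : x = chart p e n := by
  ext j
  by_cases hj : s j = 0
  · rw [chart_of_eq_zero n hj, h0 j hj]
  · obtain ⟨i, rfl⟩ := exists_index e hj
    rw [h, chart_apply]

lemma exists_chart_eq (e : Fin k ≃ {j // s j ≠ 0}) {x : Fin N → ℤ}
    (h0 : AgreeOffSupport s p x) : ∃ n, x = chart p e n := by
  refine ⟨fun i => s (e i) * (x (e i) - p (e i)), chart_ext h0 fun i => ?_⟩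
  have := (e i).2
  rcases SignType.trichotomy (s (e i)) with h | h | h <;> simp [h] at this ⊢

lemma chart_mem_cone_chart {m n : Fin k → ℤ} :
    chart p e n ∈ cone (chart p e m) s ↔ m ≤ n := by
  constructor
  · intro h i
    change m i ≤ n i
    have h1 := h (e i)
    have := (e i).2
    rw [chart_apply, chart_apply] at h1
    rcases SignType.trichotomy (s (e i)) with h | h | h <;> simp [h] at this h1 <;> omega
  · intro h j
    refine ⟨fun hj => by rw [chart_of_eq_zero _ hj, chart_of_eq_zero _ hj], fun hj => ?_,
      fun hj => ?_⟩ <;>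
    · obtain ⟨i, rfl⟩ := exists_index e (j := j) (by simp [hj])
      have : m i ≤ n i := h i
      simp [chart_apply, hj]
      omega

lemma chart_injective : Function.Injective (chart p e) := fun m n h =>
  le_antisymm ((chart_mem_cone_chart (p := p) (e := e)).1 (h ▸ self_mem_cone (chart p e m) s))
    ((chart_mem_cone_chart (p := p) (e := e)).1 (h ▸ self_mem_cone (chart p e n) s))

lemma exists_ge_of_mem_cone_chart {m : Fin k → ℤ} {x : Fin N → ℤ}
    (h : x ∈ cone (chart p e m) s) : ∃ n, m ≤ n ∧ x = chart p e n := by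
  obtain ⟨n, rfl⟩ := exists_chart_eq (p := p) e (x := x)
    fun j hj => ((chart_of_eq_zero m hj).symm.trans ((h j).1 hj).symm)
  exact ⟨n, chart_mem_cone_chart.1 h, rfl⟩

lemma eventually_chart_mem_cone (h : AgreeOffSupport s p q) :
    ∀ᶠ n in Filter.atTop, chart p e n ∈ cone q s := by
  obtain ⟨m, rfl⟩ := exists_chart_eq e h
  filter_upwards [Filter.eventually_ge_atTop m] with n hn
  exact chart_mem_cone_chart.2 hn

/-- A cone of no larger rank either misses the deep part of a given cone or determines the
same germ. -/
lemma eventually_chart_notMem_cone_or (p q : Fin N → ℤ) (e : Fin k ≃ {j // s j ≠ 0})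
    (hr : signRank t ≤ signRank s) :
    (∀ᶠ n in Filter.atTop, chart p e n ∉ cone q t) ∨ (s = t ∧ AgreeOffSupport s p q) := by
  by_cases H : ∀ j, s j ≠ 0 → t j = s j
  · obtain rfl := eq_of_signRank_le H hr
    by_cases h : AgreeOffSupport t p q
    · exact Or.inr ⟨rfl, h⟩
    · left
      simp only [AgreeOffSupport, not_forall] at h
      obtain ⟨j, hj, hne⟩ := h
      refine Filter.Eventually.of_forall fun n hn => hne ?_
      rw [← (hn j).1 hj, chart_of_eq_zero n hj]
  · left
    push Not at H
    obtain ⟨j, hj, hne⟩ := H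
    obtain ⟨i, rfl⟩ := exists_index e hj
    obtain ⟨r, hr⟩ : ∃ r : ℤ, q (e i) - p (e i) < r ∧ p (e i) - q (e i) < r :=
      ⟨(q (e i)).natAbs + (p (e i)).natAbs + 1, by omega⟩
    filter_upwards [Filter.eventually_ge_atTop fun _ => r] with n hn hmem
    have h1 := hmem (e i)
    have h2 : r ≤ n i := hn i
    rw [chart_apply] at h1
    rcases SignType.trichotomy (s (e i)) with hs | hs | hs <;>
    rcases SignType.trichotomy (t (e i)) with ht | ht | ht <;>
    simp [hs, ht] at hj hne h1 <;> omega

/-- Eventually along the cone, `g` acts in the given coordinates by the permutation `π` of the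
directions followed by a translation. -/
def ActsBy (p : Fin N → ℤ) (e : Fin k ≃ {j // s j ≠ 0}) (g : Equiv.Perm (Fin N → ℤ))
    (π : Equiv.Perm (Fin k)) : Prop :=
  ∃ c, ∀ᶠ n in Filter.atTop, g (chart p e n) = chart p e (n ∘ π.symm + c)

lemma tendsto_comp_perm_add (π : Equiv.Perm (Fin k)) (c : Fin k → ℤ) :
    Filter.Tendsto (fun n : Fin k → ℤ => n ∘ π + c) Filter.atTop Filter.atTop := by
  refine Filter.tendsto_atTop.2 fun m => ?_
  filter_upwards [Filter.eventually_ge_atTop ((m - c) ∘ π.symm)] with n hn i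
  have := hn (π i)
  simp at this ⊢
  omega

lemma ActsBy.unique {g : Equiv.Perm (Fin N → ℤ)} {π π' : Equiv.Perm (Fin k)}
    (h : ActsBy p e g π) (h' : ActsBy p e g π') : π = π' := by
  obtain ⟨c, h⟩ := h
  obtain ⟨c', h'⟩ := h'
  obtain ⟨m, hm⟩ := Filter.eventually_atTop.1 (h.and h')
  have key : ∀ n, m ≤ n → n ∘ π.symm + c = n ∘ π'.symm + c' := fun n hn =>
    chart_injective ((hm n hn).1.symm.trans (hm n hn).2)
  ext1 i
  have h1 := congrFun (key m le_rfl) (π i)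
  have h2 := congrFun (key (m + Pi.single i 1) (by
    simp only [le_add_iff_nonneg_right, Pi.single_nonneg, zero_le_one])) (π i)
  simp only [Pi.add_apply, Function.comp_apply, Equiv.symm_apply_apply, Pi.single_eq_same] at h1 h2
  by_contra hne
  rw [Pi.single_eq_of_ne (fun h => hne (by
    rw [Equiv.symm_apply_eq] at h; exact h))] at h2
  omega

lemma ActsBy.mul {g h : Equiv.Perm (Fin N → ℤ)} {π ρ : Equiv.Perm (Fin k)}
    (hg : ActsBy p e g π) (hh : ActsBy p e h ρ) : ActsBy p e (g * h) (π * ρ) := by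
  obtain ⟨c, hg⟩ := hg
  obtain ⟨d, hh⟩ := hh
  refine ⟨d ∘ π.symm + c, ?_⟩
  filter_upwards [hh, (tendsto_comp_perm_add ρ.symm d).eventually hg] with n h1 h2
  rw [Equiv.Perm.mul_apply, h1, h2]
  congr 1
  ext i
  simp [add_assoc]
  rfl

lemma actsBy_one_of_eventually {g : Equiv.Perm (Fin N → ℤ)}
    (h : ∀ᶠ n in Filter.atTop, g (chart p e n) = chart p e n) : ActsBy p e g 1 := by
  refine ⟨0, h.mono fun n hn => ?_⟩
  rw [hn]
  congr 1
  ext i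
  simp
  rfl

lemma exists_actsBy {g : Equiv.Perm (Fin N → ℤ)} {p' : Fin N → ℤ}
    (e : Fin k ≃ {j // s j ≠ 0}) (hp' : AgreeOffSupport s p p')
    (hg : IsometricOn g (cone p' s)) (hc : Commensurable (g '' cone p' s) (cone p s)) :
    ∃ π, ActsBy p e g π := by
  have hO := (isOrthantOfRank_iff.2 ⟨p', s, rfl, rfl⟩).image_of_isometricOn hg
  obtain ⟨q, t, ht, hq⟩ := isOrthantOfRank_iff.1 hO
  rw [hq, commensurable_cone_iff ht] at hc
  obtain ⟨rfl, hqp⟩ := hc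
  obtain ⟨b, B, hB, hgB⟩ := hg
  obtain ⟨τ, ε, hε, hBv⟩ := hB.exists_perm
  have hgx : ∀ x ∈ cone p' t, ∀ j, g x j = b j + ε j * x (τ j) := fun x hx j => by
    rw [hgB x hx, Pi.add_apply, hBv]
  have hgq : ∀ x ∈ cone p' t, g x ∈ cone q t := fun x hx => hq ▸ Set.mem_image_of_mem _ hx
  have hray : ∀ (r : ℕ) j, _ := fun r j => hgq _ (add_mul_mem_cone p' t r) j
  simp only [hgx _ (add_mul_mem_cone p' t _)] at hray
  have hsupp : ∀ j, t (τ j) ≠ 0 ↔ t j ≠ 0 := by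
    intro j
    constructor
    · intro h hj
      have h0 := (hray 0 j).1 hj
      have h1 := (hray 1 j).1 hj
      rcases SignType.trichotomy (t (τ j)) with h2 | h2 | h2 <;> rcases hε j with h3 | h3 <;>
      simp [h2, h3] at h h0 h1 <;> omega
    · intro hj h
      have hconst : ∀ y ∈ cone q t, y j = b j + ε j * p' (τ j) := by
        rw [← hq]
        rintro _ ⟨x, hx, rfl⟩
        rw [hgx x hx, (hx _).1 h]
      have h0 := hconst _ (add_mul_mem_cone q t 0)
      have h1 := hconst _ (add_mul_mem_cone q t 1)
      rcases SignType.trichotomy (t j) with h2 | h2 | h2 <;> simp [h2] at hj h0 h1 <;> omega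
  have hsign : ∀ j, t j ≠ 0 → ε j * (t (τ j) : ℤ) = t j := by
    intro j hj
    have hj' := (hsupp j).2 hj
    obtain ⟨r, hr⟩ : ∃ r : ℕ, (q j).natAbs + (b j).natAbs + (p' (τ j)).natAbs < r :=
      ⟨_, Nat.lt_succ_self _⟩
    have h1 := hray r j
    rcases SignType.trichotomy (t j) with h2 | h2 | h2 <;>
    rcases SignType.trichotomy (t (τ j)) with h3 | h3 | h3 <;>
    rcases hε j with h4 | h4 <;> simp [h2, h3, h4] at hj hj' h1 ⊢ <;> omega
  let π : Equiv.Perm (Fin k) := (e.symm.permCongr (τ.subtypePerm hsupp)).symm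
  have hπ : ∀ i, (e (π.symm i) : Fin N) = τ (e i) := fun i => by
    simp [π, Equiv.permCongr_apply]
  refine ⟨π, fun i => t (e i) * (b (e i) + ε (e i) * p (τ (e i)) - p (e i)), ?_⟩
  filter_upwards [eventually_chart_mem_cone hp'] with n hn
  refine chart_ext (fun j hj => ?_) fun i => ?_
  · rw [(hgq _ hn j).1 hj, hqp j hj]
  · have h1 : chart p e n (τ (e i)) = p (τ (e i)) + t (τ (e i)) * n (π.symm i) := by
      rw [← hπ, chart_apply]
    have h2 := hsign _ (e i).2
    have h3 : (t (e i) : ℤ) * t (e i) = 1 := by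
      have := (e i).2
      rcases SignType.trichotomy (t (e i)) with h | h | h <;> simp [h] at this ⊢
    rw [hgx _ hn, h1]
    simp only [Pi.add_apply, Function.comp_apply]
    linear_combination n (π.symm i) * h2 -
      (b (e i) + ε (e i) * p (τ (e i)) - p (e i)) * h3

lemma chart_zero : chart p e 0 = p :=
  (chart_ext (fun _ _ => rfl) fun i => by simp).symm

lemma chart_add (n c : Fin k → ℤ) : chart p e (n + c) = (chart p e c - p) + chart p e n := by
  refine (chart_ext (fun j hj => ?_) fun i => ?_).symm
  · simp [chart_of_eq_zero _ hj]
  · simp only [Pi.add_apply, Pi.sub_apply, chart_apply]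
    ring

lemma exists_isOrthMat_chart (p : Fin N → ℤ) (e : Fin k ≃ {j // s j ≠ 0})
    (π : Equiv.Perm (Fin k)) : ∃ (b : Fin N → ℤ) (A : Matrix (Fin N) (Fin N) ℤ),
      IsOrthMat A ∧ ∀ n, b + A.mulVec (chart p e n) = chart p e (n ∘ π.symm) := by
  classical
  let σ : Equiv.Perm (Fin N) := Equiv.Perm.extendDomain (π.symm : Equiv.Perm (Fin k)) e
  have hσ : ∀ i, σ (e i) = e (π.symm i) := fun i => Equiv.Perm.extendDomain_apply_image _ _ _
  have hσ0 : ∀ j, s j = 0 → σ j = j := fun j hj =>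
    Equiv.Perm.extendDomain_apply_not_subtype _ _ (by simpa using hj)
  let ε : Fin N → ℤ := fun j => if s j = 0 then 1 else s j * s (σ j)
  have hε : ∀ j, ε j = 1 ∨ ε j = -1 := by
    intro j
    by_cases hj : s j = 0
    · simp [ε, hj]
    · obtain ⟨i, rfl⟩ := exists_index e hj
      have h := (e (π.symm i)).2
      simp only [ε, hj, if_false, hσ]
      rcases SignType.trichotomy (s (e i)) with h1 | h1 | h1 <;>
      rcases SignType.trichotomy (s (e (π.symm i))) with h2 | h2 | h2 <;>
      simp [h1, h2] at hj h ⊢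
  obtain ⟨A, hA, hAv⟩ := exists_isOrthMat σ ε hε
  refine ⟨p - A.mulVec p, A, hA, fun n => chart_ext (fun j hj => ?_) fun i => ?_⟩
  · simp [hAv, hσ0 j hj, chart_of_eq_zero n hj]
  · have h := (e (π.symm i)).2
    simp only [Pi.add_apply, Pi.sub_apply, hAv, hσ, chart_apply, Function.comp_apply]
    simp only [ε, (e i).2, if_false, hσ]
    rcases SignType.trichotomy (s (e (π.symm i))) with h2 | h2 | h2 <;> simp [h2] at h ⊢ <;> ring

lemma exists_perm_of_cone (p : Fin N → ℤ) (e : Fin k ≃ {j // s j ≠ 0})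
    (π : Equiv.Perm (Fin k)) : ∃ g : Equiv.Perm (Fin N → ℤ), IsometricOn g (cone p s) ∧
      (∀ x ∉ cone p s, g x = x) ∧ ∀ n, 0 ≤ n → g (chart p e n) = chart p e (n ∘ π.symm) := by
  classical
  obtain ⟨b, A, hA, h⟩ := exists_isOrthMat_chart p e π
  obtain ⟨b', A', -, h'⟩ := exists_isOrthMat_chart p e π.symm
  have hmem : ∀ n : Fin k → ℤ, 0 ≤ n → chart p e n ∈ cone p s := fun n hn => by
    have := (chart_mem_cone_chart (p := p) (e := e) (m := 0)).2 hn
    rwa [chart_zero] at this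
  have hex : ∀ x ∈ cone p s, ∃ n, 0 ≤ n ∧ x = chart p e n := fun x hx =>
    exists_ge_of_mem_cone_chart (by rwa [chart_zero])
  have hcomp : ∀ (n : Fin k → ℤ) (ρ : Fin k → Fin k), 0 ≤ n → 0 ≤ n ∘ ρ := fun n ρ hn i => hn _
  let g : Equiv.Perm (Fin N → ℤ) :=
    { toFun := fun x => if x ∈ cone p s then b + A.mulVec x else x
      invFun := fun x => if x ∈ cone p s then b' + A'.mulVec x else x
      left_inv := fun x => by
        by_cases hx : x ∈ cone p s
        · obtain ⟨n, hn, rfl⟩ := hex x hx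
          simp only [hx, if_true, h, hmem _ (hcomp n π.symm hn), h']
          congr 1
          ext i
          simp
        · simp [hx]
      right_inv := fun x => by
        by_cases hx : x ∈ cone p s
        · obtain ⟨n, hn, rfl⟩ := hex x hx
          simp only [hx, if_true, h', hmem _ (hcomp n π.symm.symm hn), h]
          congr 1
          ext i
          simp
        · simp [hx] }
  refine ⟨g, ⟨b, A, hA, fun x hx => if_pos hx⟩, fun x hx => if_neg hx, fun n hn => ?_⟩
  exact (if_pos (hmem n hn)).trans (h n)

end Chart

/-- Truncation of all coordinates to the interval `[-M, M]`. -/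
def clamp {N : ℕ} (M : ℤ) (x : Fin N → ℤ) : Fin N → ℤ :=
  fun j => max (-M) (min (x j) M)

lemma isOrthant_clamp_fiber {N : ℕ} {M : ℤ} (hM : 0 < M) (v : Fin N → ℤ) :
    IsOrthant {x | clamp M x = clamp M v} := by
  refine ⟨_, isOrthantOfRank_iff.2 ⟨clamp M v,
    fun j => if M ≤ v j then 1 else if v j ≤ -M then -1 else 0, rfl, ?_⟩⟩
  ext x
  simp only [Set.mem_ofPred_eq, funext_iff, cone]
  refine forall_congr' fun j => ?_
  simp only [clamp]
  split_ifs <;> simp <;> omega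

lemma eventually_mem_cone_of_clamp_eq {N : ℕ} (p : Fin N → ℤ) (s : Fin N → SignType) :
    ∀ᶠ M in Filter.atTop, ∀ x y, clamp M x = clamp M y → x ∈ cone p s → y ∈ cone p s := by
  have hM : ∀ᶠ M : ℤ in Filter.atTop, ∀ j, ((p j).natAbs : ℤ) < M :=
    Filter.eventually_all.2 fun j => Filter.eventually_gt_atTop _
  filter_upwards [hM] with M hM x y hxy hx j
  have h1 := hM j
  have h2 := congrFun hxy j
  have h3 := hx j
  simp only [clamp] at h2
  refine ⟨fun h => ?_, fun h => ?_, fun h => ?_⟩ <;> simp [h] at h3 <;> omega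

/-- A map which is isometric on one orthant of an orthohedral set and the identity elsewhere is
piecewise isometric. -/
lemma isPeiMapOn_of_eq_outside {N : ℕ} {S L : Set (Fin N → ℤ)} (hS : IsOrthohedral S)
    (hL : IsOrthant L) {f : (Fin N → ℤ) → (Fin N → ℤ)}
    (hf : IsometricOn f L) (hid : ∀ x ∉ L, f x = x) : IsPeiMapOn S f := by
  obtain ⟨𝓛, hfin, horth, rfl⟩ := hS
  have hsat : ∀ K : Set (Fin N → ℤ), IsOrthant K →
      ∀ᶠ M in Filter.atTop, ∀ x y, clamp M x = clamp M y → x ∈ K → y ∈ K := by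
    rintro K ⟨k, hK⟩
    obtain ⟨p, s, -, rfl⟩ := isOrthantOfRank_iff.1 hK
    exact eventually_mem_cone_of_clamp_eq p s
  have hall := (Filter.eventually_all_finite hfin).2 fun K hK => hsat K (horth K hK)
  obtain ⟨M, ⟨h𝓛, hML⟩, hM⟩ :=
    ((hall.and (hsat L hL)).and (Filter.eventually_gt_atTop 0)).exists
  refine ⟨(fun v => {x | clamp M x = v}) '' (clamp M '' ⋃₀ 𝓛), ?_, ?_, ?_, ?_, ?_⟩
  · refine ((Set.finite_Icc (fun _ => -M) (fun _ => M)).subset ?_).image _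
    rintro _ ⟨x, -, rfl⟩
    exact ⟨fun j => le_max_left _ _, fun j => max_le (neg_le_self hM.le) (min_le_right _ _)⟩
  · rintro _ ⟨_, ⟨v, -, rfl⟩, rfl⟩
    exact isOrthant_clamp_fiber hM v
  · ext x
    constructor
    · exact fun hx => ⟨_, ⟨_, ⟨x, hx, rfl⟩, rfl⟩, rfl⟩
    · rintro ⟨_, ⟨_, ⟨v, ⟨K, hK, hv⟩, rfl⟩, rfl⟩, hx⟩
      exact ⟨K, hK, h𝓛 K hK v x (Eq.symm hx) hv⟩
  · rintro _ ⟨v, -, rfl⟩ _ ⟨w, -, rfl⟩ hne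
    refine Set.disjoint_left.2 fun x hx hx' => hne ?_
    simp only [id, Set.mem_ofPred_eq] at hx hx'
    rw [← hx, ← hx']
  · rintro _ ⟨_, ⟨v, -, rfl⟩, rfl⟩
    by_cases hv : v ∈ L
    · obtain ⟨a, A, hA, h⟩ := hf
      exact ⟨a, A, hA, fun x hx => h x (hML v x (Eq.symm hx) hv)⟩
    · refine ⟨0, 1, by simp [IsOrthMat], fun x hx => ?_⟩
      rw [hid x fun hxL => hv (hML x v hx hxL)]
      simp

lemma isometricOn_of_translationOn {N : ℕ} {f : (Fin N → ℤ) → (Fin N → ℤ)}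
    {L : Set (Fin N → ℤ)} (h : TranslationOn f L) : IsometricOn f L := by
  obtain ⟨a, h⟩ := h
  exact ⟨a, 1, by simp [IsOrthMat], fun x hx => by simp [h x hx]⟩

lemma commensurable_of_subset {N : ℕ} {L L' : Set (Fin N → ℤ)} {k : ℕ}
    (hL : IsOrthantOfRank L k) (hL' : IsOrthantOfRank L' k) (h : L ⊆ L') : Commensurable L L' :=
  (commensurable_iff hL hL').2 ⟨L, hL, Set.subset_inter le_rfl h⟩

lemma Commensurable.symm {N : ℕ} {L L' : Set (Fin N → ℤ)} (h : Commensurable L L') :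
    Commensurable L' L := by
  rw [Commensurable, Set.inter_comm]
  exact ⟨h.1, h.2.2, h.2.1⟩

lemma nonempty_equiv_support {N k : ℕ} {s : Fin N → SignType} (h : signRank s = k) :
    Nonempty (Fin k ≃ {j // s j ≠ 0}) :=
  ⟨(Fintype.equivFinOfCardEq (by rw [Fintype.card_subtype]; exact h)).symm⟩

section Germs

variable {N k : ℕ} {S : Set (Fin N → ℤ)} {p q : Fin N → ℤ} {s t : Fin N → SignType}
  {g : Equiv.Perm (Fin N → ℤ)}

lemma exists_actsBy_of_fixesGerm (hg : FixesGerm S k g) (hs : signRank s = k)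
    (hL : cone p s ⊆ S) (e : Fin k ≃ {j // s j ≠ 0}) : ∃ π, ActsBy p e g π := by
  obtain ⟨L', hL', -, hc, hi, hgc⟩ := hg _ (isOrthantOfRank_iff.2 ⟨p, s, hs, rfl⟩) hL
  obtain ⟨p', t, ht, rfl⟩ := isOrthantOfRank_iff.1 hL'
  rw [commensurable_cone_iff (hs.trans ht.symm)] at hc
  obtain ⟨rfl, hpp'⟩ := hc
  exact exists_actsBy e hpp' hi hgc

lemma actsBy_one_of_translatesGerm (hg : TranslatesGerm S k g) (hs : signRank s = k)
    (hL : cone p s ⊆ S) (e : Fin k ≃ {j // s j ≠ 0}) : ActsBy p e g 1 := by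
  obtain ⟨L', a, hL', -, hc, hi, hgc⟩ := hg _ (isOrthantOfRank_iff.2 ⟨p, s, hs, rfl⟩) hL
  have hO := hL'.image_of_isometricOn (isometricOn_of_translationOn ⟨a, hi⟩)
  obtain ⟨p', t, ht, rfl⟩ := isOrthantOfRank_iff.1 hL'
  obtain ⟨q, u, hu, hq⟩ := isOrthantOfRank_iff.1 hO
  rw [commensurable_cone_iff (hs.trans ht.symm)] at hc
  rw [hq, commensurable_cone_iff (hu.trans hs.symm)] at hgc
  obtain ⟨rfl, hpp'⟩ := hc
  obtain ⟨rfl, hqp⟩ := hgc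
  have hmem : g p' ∈ cone q u := hq ▸ Set.mem_image_of_mem _ (self_mem_cone p' u)
  obtain ⟨c, hc⟩ := exists_chart_eq (p := p) (x := a + p) e fun j hj => by
    have h1 := (hmem j).1 hj
    rw [hi p' (self_mem_cone _ _), Pi.add_apply] at h1
    have h2 := hpp' j hj
    have h3 := hqp j hj
    simp only [Pi.add_apply]
    omega
  refine ⟨c, ?_⟩
  filter_upwards [eventually_chart_mem_cone hpp'] with n hn
  have h1 : n ∘ (1 : Equiv.Perm (Fin k)).symm = n := rfl
  rw [hi _ hn, h1, chart_add, ← hc, add_sub_cancel_right]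

lemma exists_orthant_of_actsBy_one {e : Fin k ≃ {j // s j ≠ 0}} (hs : signRank s = k)
    (hg : ActsBy p e g 1) (hpq : AgreeOffSupport s p q) :
    ∃ L' a, IsOrthantOfRank L' k ∧ L' ⊆ cone q s ∧ Commensurable (cone q s) L' ∧
      (∀ x ∈ L', g x = a + x) ∧ Commensurable (⇑g '' L') (cone q s) := by
  obtain ⟨c, hc⟩ := hg
  have hev := eventually_chart_mem_cone (e := e) hpq
  obtain ⟨m, hm⟩ := Filter.eventually_atTop.1
    ((hc.and hev).and ((tendsto_comp_perm_add 1 c).eventually hev))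
  have hO : IsOrthantOfRank (cone (chart p e m) s) k := isOrthantOfRank_iff.2 ⟨_, s, hs, rfl⟩
  have hQ : IsOrthantOfRank (cone q s) k := isOrthantOfRank_iff.2 ⟨_, s, hs, rfl⟩
  have hsub : cone (chart p e m) s ⊆ cone q s := by
    intro x hx
    obtain ⟨n, hn, rfl⟩ := exists_ge_of_mem_cone_chart hx
    exact (hm n hn).1.2
  have htr : ∀ x ∈ cone (chart p e m) s, g x = (chart p e c - p) + x := by
    intro x hx
    obtain ⟨n, hn, rfl⟩ := exists_ge_of_mem_cone_chart hx
    rw [(hm n hn).1.1, ← chart_add]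
    rfl
  refine ⟨_, chart p e c - p, hO, hsub, (commensurable_of_subset hO hQ hsub).symm, htr,
    commensurable_of_subset (hO.image_of_isometricOn (isometricOn_of_translationOn ⟨_, htr⟩))
      hQ ?_⟩
  rintro _ ⟨x, hx, rfl⟩
  obtain ⟨n, hn, rfl⟩ := exists_ge_of_mem_cone_chart hx
  rw [(hm n hn).1.1]
  exact (hm n hn).2

lemma fixesGerm_of_perm_cone {e : Fin k ≃ {j // s j ≠ 0}} {π : Equiv.Perm (Fin k)}
    (hs : signRank s = k) (hiso : IsometricOn g (cone p s)) (hid : ∀ x ∉ cone p s, g x = x)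
    (hg : ∀ n, 0 ≤ n → g (chart p e n) = chart p e (n ∘ π.symm)) : FixesGerm S k g := by
  intro L hL _
  obtain ⟨q, t, ht, rfl⟩ := isOrthantOfRank_iff.1 hL
  obtain ⟨e'⟩ := nonempty_equiv_support ht
  rcases eventually_chart_notMem_cone_or q p e' (hs.trans ht.symm).le with h | ⟨rfl, h⟩
  · obtain ⟨L', a, h1, h2, h3, h4, h5⟩ := exists_orthant_of_actsBy_one ht
      (actsBy_one_of_eventually (h.mono fun n hn => hid _ hn)) (fun _ _ => rfl)
    exact ⟨L', h1, h2, h3, isometricOn_of_translationOn ⟨a, h4⟩, h5⟩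
  · obtain ⟨m, hm⟩ := Filter.eventually_atTop.1
      ((eventually_chart_mem_cone (e := e) fun j hj => (h j hj).symm).and
        (Filter.eventually_ge_atTop 0))
    obtain ⟨M, hM⟩ := (Set.finite_range m).bddAbove
    have hm' : m ≤ fun _ => M := fun i => hM ⟨i, rfl⟩
    have hsub : cone (chart p e fun _ => M) t ⊆ cone q t := by
      intro x hx
      obtain ⟨n, hn, rfl⟩ := exists_ge_of_mem_cone_chart hx
      exact (hm n (hm'.trans hn)).1
    have hsub' : cone (chart p e fun _ => M) t ⊆ cone p t := by
      rw [cone_subset_cone_iff]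
      refine ⟨?_, fun _ _ => rfl⟩
      have := (chart_mem_cone_chart (p := p) (e := e) (m := 0)).2 (hm _ hm').2
      rwa [chart_zero] at this
    have hO : IsOrthantOfRank (cone (chart p e fun _ => M) t) k :=
      isOrthantOfRank_iff.2 ⟨_, t, ht, rfl⟩
    have hi : IsometricOn g (cone (chart p e fun _ => M) t) := by
      obtain ⟨a, A, hA, hf⟩ := hiso
      exact ⟨a, A, hA, fun x hx => hf x (hsub' hx)⟩
    refine ⟨_, hO, hsub, (commensurable_of_subset hO hL hsub).symm, hi,
      commensurable_of_subset (hO.image_of_isometricOn hi) hL ?_⟩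
    rintro _ ⟨x, hx, rfl⟩
    obtain ⟨n, hn, rfl⟩ := exists_ge_of_mem_cone_chart hx
    rw [hg n (hm n (hm'.trans hn)).2]
    exact (hm (n ∘ π.symm) (hm'.trans fun i => hn (π.symm i))).1

/-- An element of rank at most `k` acts trivially on all but finitely many germs. -/
lemma exists_finite_of_rankLE (hg : rankLE g k) : ∃ 𝓛 : Set (Set (Fin N → ℤ)), 𝓛.Finite ∧
    ∀ (p : Fin N → ℤ) (s : Fin N → SignType) (e : Fin k ≃ {j // s j ≠ 0}), signRank s = k →
      ActsBy p e g 1 ∨ ∃ L ∈ 𝓛, IsOrthantOfRank L k ∧ Commensurable (cone p s) L := by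
  obtain ⟨T, ⟨𝓛, hfin, horth, rfl⟩, hrank, hid⟩ := hg
  refine ⟨𝓛, hfin, fun p s e hs => or_iff_not_imp_right.2 fun hnot => ?_⟩
  push Not at hnot
  refine actsBy_one_of_eventually ?_
  have hev : ∀ L ∈ 𝓛, ∀ᶠ n in Filter.atTop, chart p e n ∉ L := by
    intro L hL
    obtain ⟨l, hl⟩ := horth L hL
    have hlk : l ≤ k := (le_orthRank hl (Set.subset_sUnion_of_mem hL)).trans hrank
    obtain ⟨q, t, ht, rfl⟩ := isOrthantOfRank_iff.1 hl
    refine (eventually_chart_notMem_cone_or p q e (by omega)).resolve_right ?_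
    rintro ⟨rfl, h⟩
    exact hnot _ hL (isOrthantOfRank_iff.2 ⟨q, s, hs, rfl⟩)
      ((commensurable_cone_iff rfl).2 ⟨rfl, h⟩)
  filter_upwards [(Filter.eventually_all_finite hfin).2 hev] with n hn
  refine hid _ ?_
  rintro ⟨L, hL, hmem⟩
  exact hn L hL hmem

end Germs

/-- `C(Γ^k(S))/C^{ord}(Γ^k(S))` is isomorphic to the finitary direct sum
`⊕_{γ ∈ Γ^k(S)} Sym_k` via the action on the coordinate directions of the tangent cosets. -/
theorem stmt12 {N : ℕ} (S : Set (Fin N → ℤ)) (hS : IsOrthohedral S) (k : ℕ)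
    (hk : k ≤ orthRank S)
    (C : Subgroup (Equiv.Perm (Fin N → ℤ)))
    (hC : (C : Set (Equiv.Perm (Fin N → ℤ)))
      = {g | IsPeiPerm S g ∧ rankLE g k ∧ FixesGerm S k g}) :
    ∃ φ : ↥C →* (Germ S k → Equiv.Perm (Fin k)),
      (∀ g : ↥C, ∀ L : germSet S k, (∀ x ∈ L.1, (↑g : Equiv.Perm (Fin N → ℤ)) x = x) →
        φ g (germOf S k L) = 1) ∧
      ((φ.ker : Set ↥C) = {g : ↥C | TranslatesGerm S k (↑g : Equiv.Perm (Fin N → ℤ))}) ∧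
      (Set.range ⇑φ = {f : Germ S k → Equiv.Perm (Fin k) | {γ | f γ ≠ 1}.Finite}) := by
  classical
  have hmem : ∀ g, g ∈ C ↔ IsPeiPerm S g ∧ rankLE g k ∧ FixesGerm S k g := fun g => by
    rw [← SetLike.mem_coe, hC, Set.mem_ofPred_eq]
  have hrep : ∀ γ : Germ S k, ∃ (p : Fin N → ℤ) (s : Fin N → SignType),
      signRank s = k ∧ cone p s ⊆ S ∧ ∀ L : germSet S k,
        Commensurable (cone p s) L.1 ↔ germOf S k L = γ := by
    intro γ
    obtain ⟨L, rfl⟩ : ∃ L, germOf S k L = γ := Quot.exists_rep γ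
    obtain ⟨p, s, hs, hL⟩ := isOrthantOfRank_iff.1 L.2.1
    refine ⟨p, s, hs, hL ▸ L.2.2, fun L' => ?_⟩
    rw [← hL, ← germOf_eq_iff, eq_comm]
  choose p s hs hpS hgerm using hrep
  have e : ∀ γ, Fin k ≃ {j // s γ j ≠ 0} := fun γ => (nonempty_equiv_support (hs γ)).some
  have hO : ∀ γ, IsOrthantOfRank (cone (p γ) (s γ)) k := fun γ =>
    isOrthantOfRank_iff.2 ⟨_, _, hs γ, rfl⟩
  have hact : ∀ (g : C) γ, ∃ π, ActsBy (p γ) (e γ) g.1 π := fun g γ =>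
    exists_actsBy_of_fixesGerm ((hmem g.1).1 g.2).2.2 (hs γ) (hpS γ) (e γ)
  choose Φ hΦ using hact
  let φ : C →* (Germ S k → Equiv.Perm (Fin k)) := MonoidHom.mk' Φ fun g h => funext fun γ =>
    (hΦ (g * h) γ).unique ((hΦ g γ).mul (hΦ h γ))
  have hφ : ∀ g γ, ActsBy (p γ) (e γ) g.1 (φ g γ) := hΦ
  refine ⟨φ, fun g L hL => ?_, ?_, ?_⟩
  · obtain ⟨q, t, ht, hq⟩ := isOrthantOfRank_iff.1 L.2.1
    have hc := (hgerm _ L).2 rfl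
    rw [hq, commensurable_cone_iff ((hs _).trans ht.symm)] at hc
    refine (hφ g _).unique (actsBy_one_of_eventually ?_)
    filter_upwards [eventually_chart_mem_cone hc.2] with n hn
    exact hL _ (by rwa [hq, ← hc.1])
  · ext g
    simp only [SetLike.mem_coe, MonoidHom.mem_ker, Set.mem_ofPred_eq]
    constructor
    · intro hg L hL hLS
      have hc := (hgerm (germOf S k ⟨L, hL, hLS⟩) ⟨L, hL, hLS⟩).2 rfl
      have h1 := hφ g (germOf S k ⟨L, hL, hLS⟩)
      rw [hg, Pi.one_apply] at h1
      obtain ⟨q, t, ht, rfl⟩ := isOrthantOfRank_iff.1 hL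
      rw [commensurable_cone_iff ((hs _).trans ht.symm)] at hc
      have := exists_orthant_of_actsBy_one (hs _) h1 hc.2
      rwa [hc.1] at this
    · exact fun hg => funext fun γ =>
        (hφ g γ).unique (actsBy_one_of_translatesGerm hg (hs γ) (hpS γ) (e γ))
  · have hsingle : ∀ γ π, Pi.mulSingle γ π ∈ φ.range := by
      intro γ π
      obtain ⟨g, hiso, hid, hg⟩ := exists_perm_of_cone (p γ) (e γ) π
      have hgC : g ∈ C := by
        refine (hmem g).2 ⟨⟨isPeiMapOn_of_eq_outside hS ⟨k, hO γ⟩ hiso hid,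
          fun x hx => hid x fun h => hx (hpS γ h)⟩, ⟨_, ⟨{cone (p γ) (s γ)}, Set.finite_singleton _,
          by rintro _ rfl; exact ⟨k, hO γ⟩, by simp⟩,
          (orthRank_eq (hO γ) (hO γ) le_rfl le_rfl).le, hid⟩,
          fixesGerm_of_perm_cone (hs γ) hiso hid hg⟩
      refine ⟨⟨g, hgC⟩, funext fun γ' => (hφ _ γ').unique ?_⟩
      by_cases hγ : γ' = γ
      · subst hγ
        rw [Pi.mulSingle_eq_same]
        refine ⟨0, ?_⟩
        filter_upwards [Filter.eventually_ge_atTop 0] with n hn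
        rw [add_zero]
        exact hg n hn
      · rw [Pi.mulSingle_eq_of_ne hγ]
        refine actsBy_one_of_eventually ?_
        rcases eventually_chart_notMem_cone_or (p γ') (p γ) (e γ')
          ((hs γ).trans (hs γ').symm).le with h | h
        · exact h.mono fun n hn => hid _ hn
        · refine absurd ?_ hγ
          have h1 := (hgerm γ' ⟨_, hO γ, hpS γ⟩).1
            ((commensurable_cone_iff ((hs γ').trans (hs γ).symm)).2 h)
          have h2 := (hgerm γ ⟨_, hO γ, hpS γ⟩).1
            ((commensurable_cone_iff rfl).2 ⟨rfl, fun _ _ => rfl⟩)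
          exact h1.symm.trans h2
    apply Set.eq_of_subset_of_subset
    · rintro _ ⟨g, rfl⟩
      obtain ⟨𝓛, hfin, h⟩ := exists_finite_of_rankLE ((hmem g.1).1 g.2).2.1
      refine (hfin.biUnion (t := fun L => {γ | IsOrthantOfRank L k ∧
        Commensurable (cone (p γ) (s γ)) L}) fun L _ => Set.Subsingleton.finite ?_).subset ?_
      · rintro γ ⟨hL, h1⟩ γ' ⟨-, h2⟩
        obtain ⟨q, t, ht, rfl⟩ := isOrthantOfRank_iff.1 hL
        rw [commensurable_cone_iff ((hs _).trans ht.symm)] at h1 h2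
        have h3 := (hgerm γ ⟨_, hO γ', hpS γ'⟩).1
          ((commensurable_cone_iff ((hs γ).trans (hs γ').symm)).2 ⟨h1.1.trans h2.1.symm,
            fun j hj => (h1.2 j hj).trans (h2.2 j (by rwa [h2.1, ← h1.1])).symm⟩)
        have h4 := (hgerm γ' ⟨_, hO γ', hpS γ'⟩).1
            ((commensurable_cone_iff rfl).2 ⟨rfl, fun _ _ => rfl⟩)
        exact h3.symm.trans h4
      · intro γ hγ
        rcases h (p γ) (s γ) (e γ) (hs γ) with h1 | ⟨L, hL, hLk, hc⟩
        · exact absurd ((hφ g γ).unique h1) hγ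
        · exact Set.mem_biUnion hL ⟨hLk, hc⟩
    · intro f hf
      have key : ∀ (F : Finset (Germ S k)) (f : Germ S k → Equiv.Perm (Fin k)),
          (∀ γ ∉ F, f γ = 1) → f ∈ φ.range := by
        intro F
        induction F using Finset.induction_on with
        | empty =>
          intro f hf
          rw [show f = 1 from funext fun γ => hf γ (by simp)]
          exact one_mem _
        | insert a F _ ih =>
          intro f hf
          have hsplit : f = Function.update f a 1 * Pi.mulSingle a (f a) := by
            ext1 γ
            by_cases hγ : γ = a
            · subst hγ
              simp
            · simp [hγ]
          rw [hsplit]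
          refine mul_mem (ih _ fun γ hγ => ?_) (hsingle a (f a))
          by_cases h : γ = a
          · simp [h]
          · rw [Function.update_of_ne h]
            exact hf γ (by simp [h, hγ])
      exact key (Set.Finite.toFinset hf) f fun γ hγ => by simpa using hγ

end PeiPaper
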